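/- arXiv:1404.1448 — 3 statements merged into one kernel-verified Lean document; each statement's English description precedes it below -/
import Mathlib

section
/- If the discrete Fréchet distance satisfies d_dF(P_1, P_2) ≤ 1 + ε, then A_1 × A_2 contains a satisfying pair. -/
noncomputable section
open Real

/-- A point of the Euclidean plane. -/
def pt (x y : ℝ) : EuclideanSpace ℝ (Fin 2) := (WithLp.equiv 2 (Fin 2 → ℝ)).symm ![x, y]
/-- A single step of a discrete traversal: advance the index in the first curve,
in the second curve, or in both, each by exactly one. -/
def IsStep (a b : ℕ × ℕ) : Prop :=
  (b.1 = a.1 + 1 ∧ b.2 = a.2) ∨ (b.1 = a.1 ∧ b.2 = a.2 + 1) ∨ (b.1 = a.1 + 1 ∧ b.2 = a.2 + 1)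

/-- A discrete traversal of a pair of polygonal curves with `n` and `m` vertices
(indices are 0-based): it starts at `(0,0)`, ends at `(n-1,m-1)`, and each step
advances one index or both. -/
def IsTraversal (n m : ℕ) (T : List (ℕ × ℕ)) : Prop :=
  T.head? = some (0, 0) ∧ T.getLast? = some (n - 1, m - 1) ∧ T.Chain' IsStep ∧
    ∀ p ∈ T, p.1 < n ∧ p.2 < m

/-- The discrete Fréchet distance of two polygonal curves, given by their
(nonempty) lists of vertices: the least `D` such that some discrete traversal
has width at most `D`. -/
def dDF {d : ℕ} (P Q : List (EuclideanSpace ℝ (Fin d))) : ℝ :=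
  sInf { D | ∃ T : List (ℕ × ℕ), IsTraversal P.length Q.length T ∧
    ∀ p ∈ T, dist (P.getD p.1 0) (Q.getD p.2 0) ≤ D }
/-- `ε = 1/1000`. -/
def eps : ℝ := 1 / 1000

/-- The points `c_{1,x}^i` (`x = true` encodes `T`, `x = false` encodes `F`). -/
def cc1 (x : Bool) (i : ℕ) : EuclideanSpace ℝ (Fin 2) :=
  pt ((i : ℝ) / 3) (if x then 1 / 2 - eps else 1 / 2 + eps)

/-- The points `c_{2,x}^i`. -/
def cc2 (x : Bool) (i : ℕ) : EuclideanSpace ℝ (Fin 2) :=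
  pt ((i : ℝ) / 3) (if x then -(1 / 2) + eps else -(1 / 2) - eps)

def rr1 : EuclideanSpace ℝ (Fin 2) := pt (-(1 / 3)) (1 / 2)
def rr2 : EuclideanSpace ℝ (Fin 2) := pt (-(1 / 3)) (-(1 / 2))

/-- The clause gadget `CG(a_1, i) = c_{1, sat_1(a_1,i)}^{i mod 2}`. -/
def CG1 {A : Type*} (sat : A → ℕ → Bool) (a : A) (i : ℕ) : EuclideanSpace ℝ (Fin 2) :=
  cc1 (sat a i) (i % 2)

/-- The clause gadget `CG(a_2, i) = c_{2, sat_2(a_2,i)}^{i mod 2}`. -/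
def CG2 {A : Type*} (sat : A → ℕ → Bool) (a : A) (i : ℕ) : EuclideanSpace ℝ (Fin 2) :=
  cc2 (sat a i) (i % 2)

/-- The assignment gadget `AG(a_1) = r_1 ∘ CG(a_1,1) ∘ ⋯ ∘ CG(a_1,M)`. -/
def AG1 {A : Type*} (M : ℕ) (sat : A → ℕ → Bool) (a : A) : List (EuclideanSpace ℝ (Fin 2)) :=
  rr1 :: (List.range M).map fun k => CG1 sat a (k + 1)

/-- The assignment gadget `AG(a_2) = r_2 ∘ CG(a_2,1) ∘ ⋯ ∘ CG(a_2,M)`. -/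
def AG2 {A : Type*} (M : ℕ) (sat : A → ℕ → Bool) (a : A) : List (EuclideanSpace ℝ (Fin 2)) :=
  rr2 :: (List.range M).map fun k => CG2 sat a (k + 1)

/-- `(a_1, a_2)` is a satisfying pair: every clause `i ∈ {1,…,M}` is satisfied by
`a_1` or by `a_2`. -/
def Satisfying {A1 A2 : Type*} (M : ℕ) (sat1 : A1 → ℕ → Bool) (sat2 : A2 → ℕ → Bool)
    (a1 : A1) (a2 : A2) : Prop :=
  ∀ i : ℕ, 1 ≤ i → i ≤ M → sat1 a1 i = true ∨ sat2 a2 i = true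
def ss1 : EuclideanSpace ℝ (Fin 2) := pt (-(1 / 3)) (1 / 5)
def tt1 : EuclideanSpace ℝ (Fin 2) := pt (1 / 3) (1 / 5)
def ss2 : EuclideanSpace ℝ (Fin 2) := pt (-(1 / 3)) 0
def tt2 : EuclideanSpace ℝ (Fin 2) := pt (1 / 3) 0
def ss2star : EuclideanSpace ℝ (Fin 2) := pt (-(1 / 3)) (-(4 / 5))
def tt2star : EuclideanSpace ℝ (Fin 2) := pt (1 / 3) (-(4 / 5))
/-- The curve `P_1 = ∘_{a_1 ∈ A_1} (s_1 ∘ AG(a_1) ∘ t_1)`, where `A_1` is (enumerated as)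
`Fin K1`. -/
def Pone (M K1 : ℕ) (sat1 : Fin K1 → ℕ → Bool) : List (EuclideanSpace ℝ (Fin 2)) :=
  (List.finRange K1).flatMap fun a => ss1 :: (AG1 M sat1 a ++ [tt1])

/-- The curve `P_2 = s_2 ∘ s_2* ∘ (∘_{a_2 ∈ A_2} AG(a_2)) ∘ t_2* ∘ t_2`, where `A_2` is
(enumerated as) `Fin K2`. -/
def Ptwo (M K2 : ℕ) (sat2 : Fin K2 → ℕ → Bool) : List (EuclideanSpace ℝ (Fin 2)) :=
  ss2 :: ss2star :: (((List.finRange K2).flatMap fun a => AG2 M sat2 a) ++ [tt2star, tt2])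

/-! ### Lists built from blocks of equal length -/

theorem List.length_flatMap_of_length_eq {α β : Type*} {f : α → List β} {L : ℕ}
    (hf : ∀ a, (f a).length = L) (l : List α) : (l.flatMap f).length = l.length * L := by
  induction l with
  | nil => simp
  | cons x l ih => simp [List.flatMap_cons, ih, hf]; ring

theorem List.getD_flatMap_of_length_eq {α β : Type*} {f : α → List β} {L : ℕ}
    (hf : ∀ a, (f a).length = L) (d : β) (l : List α) (k j : ℕ) (hk : k < l.length)
    (hj : j < L) : (l.flatMap f).getD (k * L + j) d = (f l[k]).getD j d := by
  induction l generalizing k with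
  | nil => simp at hk
  | cons x l ih =>
    rw [List.flatMap_cons]
    cases k with
    | zero => rw [List.getD_append _ _ _ _ (by rw [hf]; omega)]; simp
    | succ k =>
      have e : (k + 1) * L + j = k * L + j + L := by ring
      rw [e, List.getD_append_right _ _ _ _ (by rw [hf]; omega), hf, Nat.add_sub_cancel,
        ih k (by simpa using hk)]
      simp

/-! ### The vertices of the two curves -/

section Vertices

variable {M K1 K2 : ℕ} {sat1 : Fin K1 → ℕ → Bool} {sat2 : Fin K2 → ℕ → Bool}

theorem length_Pone : (Pone M K1 sat1).length = K1 * (M + 3) := by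
  rw [Pone, List.length_flatMap_of_length_eq (L := M + 3) (by intro a; simp [AG1])]
  simp

theorem Pone_getD (a : Fin K1) {j : ℕ} (hj : j < M + 3) :
    (Pone M K1 sat1).getD (a * (M + 3) + j) 0 = (ss1 :: (AG1 M sat1 a ++ [tt1])).getD j 0 := by
  rw [Pone, List.getD_flatMap_of_length_eq (L := M + 3) (by intro a; simp [AG1]) _ _ _ _
    (by simp) hj]
  simp

theorem Pone_getD_zero (a : Fin K1) : (Pone M K1 sat1).getD (a * (M + 3)) 0 = ss1 := by
  simpa using Pone_getD (sat1 := sat1) a (show 0 < M + 3 by omega)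

theorem Pone_getD_one (a : Fin K1) : (Pone M K1 sat1).getD (a * (M + 3) + 1) 0 = rr1 := by
  rw [Pone_getD a (by omega)]; simp [AG1]

theorem Pone_getD_clause (a : Fin K1) {i : ℕ} (hi : i < M) :
    (Pone M K1 sat1).getD (a * (M + 3) + (i + 2)) 0 = CG1 sat1 a (i + 1) := by
  rw [Pone_getD a (by omega), List.getD_cons_succ, List.getD_append _ _ _ _ (by simp [AG1]; omega)]
  simp [AG1, hi]

theorem length_Ptwo : (Ptwo M K2 sat2).length = K2 * (M + 1) + 4 := by
  simp only [Ptwo, List.length_cons, List.length_append, List.length_nil]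
  rw [List.length_flatMap_of_length_eq (L := M + 1) (by intro a; simp [AG2])]
  simp

theorem Ptwo_getD_one : (Ptwo M K2 sat2).getD 1 0 = ss2star := by
  simp [Ptwo]

theorem Ptwo_getD_tt2star : (Ptwo M K2 sat2).getD (K2 * (M + 1) + 2) 0 = tt2star := by
  have hl := List.length_flatMap_of_length_eq (f := fun a => AG2 M sat2 a) (L := M + 1)
    (by intro a; simp [AG2]) (List.finRange K2)
  rw [List.length_finRange] at hl
  rw [Ptwo, List.getD_cons_succ, List.getD_cons_succ,
    List.getD_append_right _ _ _ _ hl.le, hl]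
  simp

theorem Ptwo_getD (b : Fin K2) {j : ℕ} (hj : j < M + 1) :
    (Ptwo M K2 sat2).getD (b * (M + 1) + j + 2) 0 = (AG2 M sat2 b).getD j 0 := by
  have hf : ∀ a, (AG2 M sat2 a).length = M + 1 := by intro a; simp [AG2]
  have hl := List.length_flatMap_of_length_eq hf (List.finRange K2)
  rw [List.length_finRange] at hl
  have hb : (b + 1) * (M + 1) ≤ K2 * (M + 1) := Nat.mul_le_mul_right _ b.2
  rw [Ptwo, List.getD_cons_succ, List.getD_cons_succ,
    List.getD_append _ _ _ _ (by rw [hl]; linarith),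
    List.getD_flatMap_of_length_eq hf _ _ _ _ (by simp) hj]
  simp

theorem Ptwo_getD_rr2 (b : Fin K2) : (Ptwo M K2 sat2).getD (b * (M + 1) + 2) 0 = rr2 := by
  simpa [AG2] using Ptwo_getD (sat2 := sat2) b (show 0 < M + 1 by omega)

theorem Ptwo_getD_clause (b : Fin K2) {i : ℕ} (hi : i < M) :
    (Ptwo M K2 sat2).getD (b * (M + 1) + (i + 1) + 2) 0 = CG2 sat2 b (i + 1) := by
  rw [Ptwo_getD b (by omega)]
  simp [AG2, hi]

end Vertices

/-! ### Distances between vertices -/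

theorem dist_pt_lt {a b c d : ℝ} (h : dist (pt a b) (pt c d) < 1 + 2 * eps) :
    (a - c) ^ 2 + (b - d) ^ 2 < (501 / 500) ^ 2 := by
  rw [EuclideanSpace.dist_eq, Real.sqrt_lt' (by norm_num [eps])] at h
  simp only [pt, eps, Fin.sum_univ_two, Real.dist_eq, sq_abs] at h
  norm_num at h ⊢
  exact h

theorem CG_near {A B : Type*} {sat1 : A → ℕ → Bool} {sat2 : B → ℕ → Bool} {a : A} {b : B}
    {i j : ℕ} (h : dist (CG1 sat1 a i) (CG2 sat2 b j) < 1 + 2 * eps) :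
    i % 2 = j % 2 ∧ (sat1 a i = true ∨ sat2 b j = true) := by
  rw [CG1, CG2, cc1, cc2] at h
  have h := dist_pt_lt h
  rcases Nat.mod_two_eq_zero_or_one i with hi | hi <;>
  rcases Nat.mod_two_eq_zero_or_one j with hj | hj <;>
  cases h1 : sat1 a i <;> cases h2 : sat2 b j <;>
  simp only [hi, hj, h1, h2] at h ⊢ <;>
  first | (norm_num; done) | norm_num [eps] at h

theorem not_near_rr1_CG2 {B : Type*} {sat2 : B → ℕ → Bool} {b : B} {j : ℕ} :
    ¬ dist rr1 (CG2 sat2 b j) < 1 + 2 * eps := by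
  intro h
  rw [rr1, CG2, cc2] at h
  have h := dist_pt_lt h
  rcases Nat.mod_two_eq_zero_or_one j with hj | hj <;>
  cases h2 : sat2 b j <;> simp only [hj, h2] at h <;> norm_num [eps] at h

theorem not_near_CG1_rr2 {A : Type*} {sat1 : A → ℕ → Bool} {a : A} {i : ℕ} :
    ¬ dist (CG1 sat1 a i) rr2 < 1 + 2 * eps := by
  intro h
  rw [rr2, CG1, cc1] at h
  have h := dist_pt_lt h
  rcases Nat.mod_two_eq_zero_or_one i with hi | hi <;>
  cases h2 : sat1 a i <;> simp only [hi, h2] at h <;> norm_num [eps] at h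

theorem not_near_CG1_ss2star {A : Type*} {sat1 : A → ℕ → Bool} {a : A} {i : ℕ} :
    ¬ dist (CG1 sat1 a i) ss2star < 1 + 2 * eps := by
  intro h
  rw [ss2star, CG1, cc1] at h
  have h := dist_pt_lt h
  rcases Nat.mod_two_eq_zero_or_one i with hi | hi <;>
  cases h2 : sat1 a i <;> simp only [hi, h2] at h <;> norm_num [eps] at h

theorem not_near_rr1_ss2star : ¬ dist rr1 ss2star < 1 + 2 * eps := fun h => by
  have := dist_pt_lt h
  norm_num at this

theorem not_near_tt1_ss2star : ¬ dist tt1 ss2star < 1 + 2 * eps := fun h => by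
  have := dist_pt_lt h
  norm_num at this

theorem not_near_rr1_tt2star : ¬ dist rr1 tt2star < 1 + 2 * eps := fun h => by
  have := dist_pt_lt h
  norm_num at this

theorem not_near_ss1_tt2star : ¬ dist ss1 tt2star < 1 + 2 * eps := fun h => by
  have := dist_pt_lt h
  norm_num at this

/-- Only the vertices `s_1` of the first curve are close to `s_2*`. -/
theorem exists_eq_of_near_ss2star {M K1 : ℕ} {sat1 : Fin K1 → ℕ → Bool} {p : ℕ}
    (hp : p < K1 * (M + 3))
    (h : dist ((Pone M K1 sat1).getD p 0) ss2star < 1 + 2 * eps) :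
    ∃ a : Fin K1, p = a * (M + 3) := by
  have hj : p % (M + 3) < M + 3 := Nat.mod_lt _ (by omega)
  refine ⟨⟨p / (M + 3), Nat.div_lt_of_lt_mul (by rwa [mul_comm])⟩, ?_⟩
  set a : Fin K1 := ⟨p / (M + 3), Nat.div_lt_of_lt_mul (by rwa [mul_comm])⟩
  have hpa : p = a * (M + 3) + p % (M + 3) := (Nat.div_add_mod' p (M + 3)).symm
  generalize p % (M + 3) = j at hj hpa
  rw [hpa] at h
  match j, hj with
  | 0, _ => exact hpa
  | 1, _ => rw [Pone_getD_one] at h; exact absurd h not_near_rr1_ss2star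
  | i + 2, hj =>
    rcases Nat.lt_or_ge i M with hi | hi
    · rw [Pone_getD_clause a hi] at h; exact absurd h not_near_CG1_ss2star
    · obtain rfl : i = M := by omega
      rw [Pone_getD a hj, List.getD_cons_succ,
        List.getD_append_right _ _ _ _ (by simp [AG1])] at h
      exact absurd (by simpa [AG1] using h) not_near_tt1_ss2star

/-- Among the vertices strictly between `s_2*` and `t_2*`, only the vertices `r_2` are close
to `r_1`. -/
theorem exists_eq_of_near_rr1 {M K2 : ℕ} {sat2 : Fin K2 → ℕ → Bool} {q : ℕ} (hq : 2 ≤ q)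
    (hq' : q < K2 * (M + 1) + 2)
    (h : dist rr1 ((Ptwo M K2 sat2).getD q 0) < 1 + 2 * eps) :
    ∃ b : Fin K2, q = b * (M + 1) + 2 := by
  obtain ⟨q, rfl⟩ := Nat.exists_eq_add_of_le' hq
  have hj : q % (M + 1) < M + 1 := Nat.mod_lt _ (by omega)
  have hlt : q / (M + 1) < K2 := Nat.div_lt_of_lt_mul (by rw [mul_comm]; omega)
  refine ⟨⟨q / (M + 1), hlt⟩, ?_⟩
  set b : Fin K2 := ⟨q / (M + 1), hlt⟩
  have hqb : q = b * (M + 1) + q % (M + 1) := (Nat.div_add_mod' q (M + 1)).symm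
  generalize q % (M + 1) = j at hj hqb
  rw [hqb] at h
  match j, hj with
  | 0, _ => rw [← hqb.trans (add_zero _)]
  | i + 1, hj =>
    rw [Ptwo_getD_clause b (by omega)] at h
    exact absurd h not_near_rr1_CG2

/-! ### Traversals -/

theorem exists_nat_eq_of_step {g : ℕ → ℕ} {a b v : ℕ} (hab : a ≤ b)
    (hg : ∀ k, a ≤ k → k < b → g (k + 1) ≤ g k + 1) (ha : g a ≤ v) (hb : v ≤ g b) :
    ∃ k, a ≤ k ∧ k ≤ b ∧ g k = v := by
  induction b, hab using Nat.le_induction with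
  | base => exact ⟨a, le_rfl, le_rfl, le_antisymm ha hb⟩
  | succ b hab ih =>
    by_cases h : v ≤ g b
    · obtain ⟨k, h1, h2, h3⟩ := ih (fun k h1 h2 => hg k h1 (by omega)) h
      exact ⟨k, h1, by omega, h3⟩
    · exact ⟨b + 1, by omega, le_rfl, by have := hg b hab (by omega); omega⟩

theorem le_of_forall_step {g : ℕ → ℕ} {a b : ℕ} (hab : a ≤ b)
    (hg : ∀ k, a ≤ k → k < b → g k ≤ g (k + 1)) : g a ≤ g b := by
  induction b, hab using Nat.le_induction with
  | base => exact le_rfl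
  | succ b hab ih =>
    exact (ih fun k h1 h2 => hg k h1 (by omega)).trans (hg b hab (by omega))

theorem exists_isTraversal {n m : ℕ} (hn : 0 < n) (hm : 0 < m) : ∃ T, IsTraversal n m T := by
  have extend : ∀ {n m n' m' : ℕ}, 0 < n → 0 < m → n ≤ n' → m ≤ m' →
      IsStep (n - 1, m - 1) (n' - 1, m' - 1) → (∃ T, IsTraversal n m T) →
      ∃ T, IsTraversal n' m' T := by
    rintro n m n' m' hn hm hnn hmm hs ⟨T, h0, h1, h2, h3⟩
    refine ⟨T ++ [(n' - 1, m' - 1)], ?_, by simp, ?_, ?_⟩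
    · simp [List.head?_append, h0]
    · refine List.isChain_append.2 ⟨h2, List.isChain_singleton _, ?_⟩
      intro x hx y hy
      rw [h1] at hx
      simp only [Option.mem_def, Option.some.injEq, List.head?_cons] at hx hy
      subst hx hy
      exact hs
    · intro p hp
      rcases List.mem_append.1 hp with hp | hp
      · have := h3 p hp
        omega
      · rw [List.mem_singleton.1 hp]
        dsimp only
        omega
  induction n, hn using Nat.le_induction with
  | base =>
    induction m, hm using Nat.le_induction with
    | base => exact ⟨[(0, 0)], rfl, rfl, List.isChain_singleton _, by simp⟩
    | succ m hm ih =>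
      exact extend one_pos hm le_rfl (Nat.le_succ m) (by right; left; simp; omega) ih
  | succ n hn ih => exact extend hn hm (Nat.le_succ n) le_rfl (by left; simp; omega) ih

theorem exists_traversal_of_dDF_lt {d : ℕ} {P Q : List (EuclideanSpace ℝ (Fin d))} {D : ℝ}
    (hP : 0 < P.length) (hQ : 0 < Q.length) (h : dDF P Q < D) :
    ∃ T, IsTraversal P.length Q.length T ∧
      ∀ p ∈ T, dist (P.getD p.1 0) (Q.getD p.2 0) < D := by
  obtain ⟨T₀, hT₀⟩ := exists_isTraversal hP hQ
  obtain ⟨B, hB⟩ : ∃ B, ∀ p ∈ T₀, dist (P.getD p.1 0) (Q.getD p.2 0) ≤ B := by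
    obtain ⟨B, hB⟩ := (T₀.toFinset.image
      fun p => dist (P.getD p.1 0) (Q.getD p.2 0)).bddAbove
    exact ⟨B, fun p hp => hB (Finset.mem_coe.2
      (Finset.mem_image_of_mem _ (List.mem_toFinset.2 hp)))⟩
  have hne : {B | ∃ T, IsTraversal P.length Q.length T ∧
      ∀ p ∈ T, dist (P.getD p.1 0) (Q.getD p.2 0) ≤ B}.Nonempty := ⟨B, T₀, hT₀, hB⟩
  obtain ⟨D', ⟨T, hT, hD'⟩, hlt⟩ := exists_lt_of_csInf_lt hne h
  exact ⟨T, hT, fun p hp => (hD' p hp).trans_lt hlt⟩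

/-- A traversal as a sequence of index pairs. -/
theorem IsTraversal.exists_seq {n m : ℕ} {T : List (ℕ × ℕ)} (hT : IsTraversal n m T) :
    ∃ (N : ℕ) (f : ℕ → ℕ × ℕ), f 0 = (0, 0) ∧ f N = (n - 1, m - 1) ∧
      (∀ k < N, IsStep (f k) (f (k + 1))) ∧ ∀ k ≤ N, f k ∈ T := by
  obtain ⟨h0, h1, h2, -⟩ := hT
  have hpos : 0 < T.length := by
    rw [List.length_pos_iff]
    rintro rfl
    simp at h0
  refine ⟨T.length - 1, fun k => T.getD k (0, 0), ?_, ?_, ?_, ?_⟩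
  · rw [List.head?_eq_getElem?] at h0
    simp [List.getD, h0]
  · rw [List.getLast?_eq_getElem?] at h1
    simp [List.getD, h1]
  · intro k hk
    have := List.isChain_iff_getElem.1 h2 k (by omega)
    rwa [← List.getD_eq_getElem _ (0, 0), ← List.getD_eq_getElem _ (0, 0)] at this
  · intro k hk
    have hk' : k < T.length := by omega
    simp only [List.getD_eq_getElem _ _ hk']
    exact List.getElem_mem hk'

/-- if `d_dF(P_1, P_2) ≤ 1 + ε`, then `A_1 × A_2` contains a
satisfying pair. -/
theorem stmt4 (M K1 K2 : ℕ) (hM : 1 ≤ M) (hK1 : 1 ≤ K1) (hK2 : 1 ≤ K2)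
    (sat1 : Fin K1 → ℕ → Bool) (sat2 : Fin K2 → ℕ → Bool)
    (h : dDF (Pone M K1 sat1) (Ptwo M K2 sat2) ≤ 1 + eps) :
    ∃ a1 : Fin K1, ∃ a2 : Fin K2, Satisfying M sat1 sat2 a1 a2 := by
  have hlt : dDF (Pone M K1 sat1) (Ptwo M K2 sat2) < 1 + 2 * eps :=
    h.trans_lt (by norm_num [eps])
  obtain ⟨T, hT, hD⟩ := exists_traversal_of_dDF_lt
    (by rw [length_Pone]; positivity) (by rw [length_Ptwo]; positivity) hlt
  obtain ⟨N, f, hf0, hfN, hstep, hmem⟩ := hT.exists_seq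
  have hbd : ∀ k ≤ N, (f k).1 < K1 * (M + 3) := fun k hk => by
    simpa only [length_Pone] using (hT.2.2.2 _ (hmem k hk)).1
  have hnear : ∀ k ≤ N, dist ((Pone M K1 sat1).getD (f k).1 0)
      ((Ptwo M K2 sat2).getD (f k).2 0) < 1 + 2 * eps := fun k hk => hD _ (hmem k hk)
  rw [length_Pone, length_Ptwo] at hfN
  have mono1 : ∀ a b, a ≤ b → b ≤ N → (f a).1 ≤ (f b).1 := fun a b hab hb =>
    le_of_forall_step (g := fun k => (f k).1) hab fun k _ hk => by
      rcases hstep k (by omega) with h | h | h <;> omega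
  have mono2 : ∀ a b, a ≤ b → b ≤ N → (f a).2 ≤ (f b).2 := fun a b hab hb =>
    le_of_forall_step (g := fun k => (f k).2) hab fun k _ hk => by
      rcases hstep k (by omega) with h | h | h <;> omega
  have visit2 : ∀ v, v ≤ K2 * (M + 1) + 3 → ∃ k ≤ N, (f k).2 = v := fun v hv => by
    obtain ⟨k, -, hk, hv⟩ := exists_nat_eq_of_step (g := fun k => (f k).2) (v := v) N.zero_le
      (fun k _ hk => by rcases hstep k hk with h | h | h <;> omega)
      (by simp [hf0]) (by simp only [hfN]; omega)
    exact ⟨k, hk, hv⟩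
  obtain ⟨k₁, hk₁, hs⟩ := visit2 1 (by omega)
  obtain ⟨k₂, hk₂, ht⟩ := visit2 (K2 * (M + 1) + 2) (by omega)
  have hpos : 0 < K2 * (M + 1) := by positivity
  have h12 : k₁ ≤ k₂ := by
    by_contra! hc
    have := mono2 k₂ k₁ hc.le hk₁
    omega
  obtain ⟨a, ha⟩ : ∃ a : Fin K1, (f k₁).1 = a * (M + 3) := by
    have := hnear k₁ hk₁
    rw [hs, Ptwo_getD_one] at this
    exact exists_eq_of_near_ss2star (hbd _ hk₁) this
  have hlt2 : a * (M + 3) + 1 ≤ (f k₂).1 := by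
    have h1 := mono1 _ _ h12 hk₂
    rw [ha] at h1
    refine Nat.lt_of_le_of_ne h1 fun he => ?_
    have := hnear k₂ hk₂
    rw [ht, Ptwo_getD_tt2star, ← he, Pone_getD_zero] at this
    exact not_near_ss1_tt2star this
  obtain ⟨k₃, h13, h32, hk₃⟩ := exists_nat_eq_of_step (g := fun k => (f k).1) h12
    (fun k _ hk => by rcases hstep k (by omega) with h | h | h <;> omega)
    (show (f k₁).1 ≤ a * (M + 3) + 1 by omega) hlt2
  have h3N : k₃ ≤ N := by omega
  have hr := hnear k₃ h3N
  rw [hk₃, Pone_getD_one] at hr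
  obtain ⟨b, hb⟩ : ∃ b : Fin K2, (f k₃).2 = b * (M + 1) + 2 := by
    have hge := mono2 _ _ h13 h3N
    have hle := mono2 _ _ h32 hk₂
    refine exists_eq_of_near_rr1 (Nat.lt_of_le_of_ne (hs ▸ hge) fun he => ?_)
      (Nat.lt_of_le_of_ne (ht ▸ hle) fun he => ?_) hr
    · rw [← he, Ptwo_getD_one] at hr
      exact not_near_rr1_ss2star hr
    · rw [he, Ptwo_getD_tt2star] at hr
      exact not_near_rr1_tt2star hr
  have hab : (a + 1) * (M + 3) ≤ K1 * (M + 3) := Nat.mul_le_mul_right _ a.2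
  rw [add_mul] at hab
  have sync : ∀ i ≤ M, k₃ + i ≤ N ∧ (f (k₃ + i)).1 = a * (M + 3) + (i + 1) ∧
      (f (k₃ + i)).2 = b * (M + 1) + i + 2 := by
    intro i
    induction i with
    | zero => exact fun _ => ⟨h3N, hk₃, hb⟩
    | succ i ih =>
      intro hi
      obtain ⟨hN, h1, h2⟩ := ih (by omega)
      have hN' : k₃ + i < N := by
        refine Nat.lt_of_le_of_ne hN fun he => ?_
        rw [he, hfN] at h1
        dsimp only at h1
        omega
      have hn := hnear (k₃ + i + 1) hN'
      refine ⟨hN', ?_⟩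
      rw [← add_assoc]
      rcases hstep _ hN' with ⟨e1, e2⟩ | ⟨e1, e2⟩ | ⟨e1, e2⟩
      · exfalso
        rw [e1, e2, h1, h2, add_assoc _ (i + 1), Pone_getD_clause a (by omega)] at hn
        cases i with
        | zero => exact not_near_CG1_rr2 ((Ptwo_getD_rr2 (sat2 := sat2) b) ▸ hn)
        | succ i =>
          rw [Ptwo_getD_clause b (by omega)] at hn
          have := (CG_near hn).1
          omega
      · exfalso
        rw [e1, e2, h1, h2, show b * (M + 1) + i + 2 + 1 = b * (M + 1) + (i + 1) + 2 by ring,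
          Ptwo_getD_clause b (by omega)] at hn
        cases i with
        | zero => exact not_near_rr1_CG2 ((Pone_getD_one (sat1 := sat1) a) ▸ hn)
        | succ i =>
          rw [Pone_getD_clause a (by omega)] at hn
          have := (CG_near hn).1
          omega
      · omega
  refine ⟨a, b, fun i hi1 hiM => ?_⟩
  obtain ⟨i, rfl⟩ := Nat.exists_eq_add_of_le' hi1
  obtain ⟨hN, h1, h2⟩ := sync (i + 1) hiM
  have hn := hnear _ hN
  rw [h1, h2, Pone_getD_clause a (by omega), Ptwo_getD_clause b (by omega)] at hn
  exact (CG_near hn).2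
end
end

section
/- If A_1 × A_2 contains a satisfying pair, then the continuous Fréchet distance satisfies d_F(P_1, P_2) ≤ 1. -/
noncomputable section
open Real

/-- The piecewise-linear parametrization of the polygonal curve with vertex list `P`
(vertices `p_1, …, p_n`), defined on `[1, n]` by `P(i+λ) = (1-λ)·p_i + λ·p_{i+1}`. -/
def polyEval {d : ℕ} (P : List (EuclideanSpace ℝ (Fin d))) (t : ℝ) : EuclideanSpace ℝ (Fin d) :=
  (1 - Int.fract t) • P.getD (⌊t⌋ - 1).toNat 0 + Int.fract t • P.getD ⌊t⌋.toNat 0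

/-- `φ` is a continuous nondecreasing map from `[0,1]` onto `[1,n]`. -/
def IsReparam (n : ℕ) (φ : ℝ → ℝ) : Prop :=
  ContinuousOn φ (Set.Icc 0 1) ∧ MonotoneOn φ (Set.Icc 0 1) ∧
    φ '' Set.Icc 0 1 = Set.Icc 1 (n : ℝ)

/-- The continuous Fréchet distance of two polygonal curves, given by their
(nonempty) lists of vertices. -/
def dF {d : ℕ} (P Q : List (EuclideanSpace ℝ (Fin d))) : ℝ :=
  sInf { D | ∃ φ₁ φ₂ : ℝ → ℝ, IsReparam P.length φ₁ ∧ IsReparam Q.length φ₂ ∧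
    ∀ t ∈ Set.Icc (0:ℝ) 1, dist (polyEval P (φ₁ t)) (polyEval Q (φ₂ t)) ≤ D }
/-- `P` and `Q` can be traversed simultaneously, vertex by vertex, moving forward on one or both
lists in each step, so that the current vertices always stay within distance `δ`. -/
inductive Coupling {d : ℕ} (δ : ℝ) :
    List (EuclideanSpace ℝ (Fin d)) → List (EuclideanSpace ℝ (Fin d)) → Prop
  | single {p q} : dist p q ≤ δ → Coupling δ [p] [q]
  | left {p q P Q} : dist p q ≤ δ → Coupling δ P (q :: Q) → Coupling δ (p :: P) (q :: Q)
  | right {p q P Q} : dist p q ≤ δ → Coupling δ (p :: P) Q → Coupling δ (p :: P) (q :: Q)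
  | both {p q P Q} : dist p q ≤ δ → Coupling δ P Q → Coupling δ (p :: P) (q :: Q)

section Reparametrization

variable {d : ℕ} {P Q : List (EuclideanSpace ℝ (Fin d))} {δ : ℝ}

theorem polyEval_one (p : EuclideanSpace ℝ (Fin d)) : polyEval (p :: P) 1 = p := by
  simp [polyEval]

theorem polyEval_cons_add_one (p : EuclideanSpace ℝ (Fin d)) {t : ℝ} (ht : 1 ≤ t) :
    polyEval (p :: P) (t + 1) = polyEval P t := by
  have h1 : 1 ≤ ⌊t⌋ := Int.le_floor.2 (by simpa using ht)
  obtain ⟨n, hn⟩ : ∃ n : ℕ, ⌊t⌋ = n + 1 := ⟨(⌊t⌋ - 1).toNat, by omega⟩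
  have h2 : ((n : ℤ) + 1 + 1).toNat = n + 1 + 1 := by omega
  have h3 : ((n : ℤ) + 1).toNat = n + 1 := by omega
  simp [polyEval, hn, h2, h3]

theorem polyEval_cons_one_add (p : EuclideanSpace ℝ (Fin d)) {t : ℝ} (h0 : 0 ≤ t) (h1 : t ≤ 1) :
    polyEval (p :: P) (1 + t) = (1 - t) • p + t • polyEval P 1 := by
  rcases h1.eq_or_lt with rfl | h1
  · simpa using polyEval_cons_add_one (P := P) p le_rfl
  · have hfl : ⌊1 + t⌋ = 1 := Int.floor_eq_iff.2 ⟨by simpa using h0, by simpa using h1⟩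
    have hfr : Int.fract t = t := Int.fract_eq_self.2 ⟨h0, h1⟩
    simp [polyEval, hfl, hfr]

theorem dist_convexCombo_le {E : Type*} [NormedAddCommGroup E] [NormedSpace ℝ E] {p q p' q' : E}
    {t : ℝ} (h0 : 0 ≤ t) (h1 : t ≤ 1) (h : dist p q ≤ δ) (h' : dist p' q' ≤ δ) :
    dist ((1 - t) • p + t • p') ((1 - t) • q + t • q') ≤ δ := by
  calc dist ((1 - t) • p + t • p') ((1 - t) • q + t • q')
      ≤ dist ((1 - t) • p) ((1 - t) • q) + dist (t • p') (t • q') := dist_add_add_le _ _ _ _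
    _ = (1 - t) * dist p q + t * dist p' q' := by
        rw [dist_smul₀, dist_smul₀, Real.norm_of_nonneg h0, Real.norm_of_nonneg (by linarith)]
    _ ≤ (1 - t) * δ + t * δ := by gcongr
    _ = δ := by ring

/-- `f` traverses `[1, n]` during the time interval `[0, N]`, and rests at `1` before. -/
structure IsTraversal_s8 (N : ℝ) (n : ℕ) (f : ℝ → ℝ) : Prop where
  continuous : Continuous f
  monotone : Monotone f
  apply_of_nonpos : ∀ t ≤ 0, f t = 1
  apply_end : f N = n

namespace IsTraversal_s8

variable {N : ℝ} {n : ℕ} {f : ℝ → ℝ}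

theorem one_le (hf : IsTraversal_s8 N n f) (t : ℝ) : 1 ≤ f t := by
  rw [← hf.apply_of_nonpos (min t 0) (min_le_right _ _)]
  exact hf.monotone (min_le_left _ _)

/-- Wait for one unit of time before starting. -/
theorem wait (hf : IsTraversal_s8 N n f) : IsTraversal_s8 (N + 1) n fun t => f (t - 1) where
  continuous := hf.continuous.comp (by fun_prop)
  monotone _ _ hab := hf.monotone (by linarith)
  apply_of_nonpos t ht := hf.apply_of_nonpos _ (by linarith)
  apply_end := by simpa using hf.apply_end

/-- Traverse an additional first segment at unit speed. -/
theorem advance (hN : 0 ≤ N) (hf : IsTraversal_s8 N n f) :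
    IsTraversal_s8 (N + 1) (n + 1) fun t => f (t - 1) + max 0 (min 1 t) where
  continuous := (hf.continuous.comp (by fun_prop)).add (by fun_prop)
  monotone _ _ hab := add_le_add (hf.monotone (by linarith))
    (max_le_max le_rfl (min_le_min le_rfl hab))
  apply_of_nonpos t ht := by
    simp [hf.apply_of_nonpos (t - 1) (by linarith), min_eq_right (ht.trans zero_le_one), ht]
  apply_end := by simp [hf.apply_end, hN]

theorem isReparam (hN : 0 ≤ N) (hf : IsTraversal_s8 N n f) : IsReparam n fun t => f (N * t) := by
  have hc : Continuous fun t => f (N * t) := hf.continuous.comp (by fun_prop)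
  have hm : Monotone fun t => f (N * t) := fun a b hab =>
    hf.monotone (mul_le_mul_of_nonneg_left hab hN)
  have h0 : f (N * 0) = 1 := hf.apply_of_nonpos _ (by simp)
  have h1 : f (N * 1) = n := by simpa using hf.apply_end
  refine ⟨hc.continuousOn, hm.monotoneOn _, Set.Subset.antisymm ?_ ?_⟩
  · rintro _ ⟨t, ht, rfl⟩
    exact ⟨h0 ▸ hm ht.1, h1 ▸ hm ht.2⟩
  · have := intermediate_value_Icc zero_le_one hc.continuousOn
    simpa only [h0, h1] using this

theorem polyEval_wait (hf : IsTraversal_s8 N (P.length) f) {t : ℝ} (h1 : t ≤ 1) :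
    polyEval P (f (t - 1)) = (1 - t) • polyEval P 1 + t • polyEval P 1 := by
  rw [hf.apply_of_nonpos _ (by linarith), ← add_smul, sub_add_cancel, one_smul]

theorem polyEval_advance (hf : IsTraversal_s8 N (P.length) f) (p : EuclideanSpace ℝ (Fin d)) {t : ℝ}
    (h0 : 0 ≤ t) (h1 : t ≤ 1) :
    polyEval (p :: P) (f (t - 1) + max 0 (min 1 t)) = (1 - t) • p + t • polyEval P 1 := by
  rw [hf.apply_of_nonpos _ (by linarith), min_eq_right h1, max_eq_right h0,
    polyEval_cons_one_add p h0 h1]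

theorem polyEval_advance_of_one_le (hf : IsTraversal_s8 N (P.length) f)
    (p : EuclideanSpace ℝ (Fin d)) {t : ℝ} (h1 : 1 ≤ t) :
    polyEval (p :: P) (f (t - 1) + max 0 (min 1 t)) = polyEval P (f (t - 1)) := by
  rw [min_eq_left h1, max_eq_right zero_le_one, polyEval_cons_add_one p (hf.one_le _)]

end IsTraversal_s8

theorem Coupling.exists_traversal (h : Coupling δ P Q) :
    ∃ (N : ℝ) (f g : ℝ → ℝ), 0 ≤ N ∧ IsTraversal_s8 N P.length f ∧ IsTraversal_s8 N Q.length g ∧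
      ∀ t ∈ Set.Icc 0 N, dist (polyEval P (f t)) (polyEval Q (g t)) ≤ δ := by
  induction h with
  | single h =>
    have hc : IsTraversal_s8 0 1 fun _ => 1 :=
      ⟨continuous_const, monotone_const, fun _ _ => rfl, by simp⟩
    exact ⟨0, _, _, le_rfl, hc, hc, fun t _ => by simpa only [polyEval_one] using h⟩
  | @left p q P Q h _ ih =>
    obtain ⟨N, f, g, hN, hf, hg, hd⟩ := ih
    refine ⟨N + 1, _, _, by linarith, hf.advance hN, hg.wait, fun t ht => ?_⟩
    rcases le_total t 1 with h1 | h1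
    · have hd0 := hd 0 ⟨le_rfl, hN⟩
      rw [hf.apply_of_nonpos 0 le_rfl, hg.apply_of_nonpos 0 le_rfl] at hd0
      rw [hf.polyEval_advance p ht.1 h1, hg.polyEval_wait h1]
      exact dist_convexCombo_le ht.1 h1 (by rwa [polyEval_one]) hd0
    · rw [hf.polyEval_advance_of_one_le p h1]
      exact hd _ ⟨by linarith, by linarith [ht.2]⟩
  | @right p q P Q h _ ih =>
    obtain ⟨N, f, g, hN, hf, hg, hd⟩ := ih
    refine ⟨N + 1, _, _, by linarith, hf.wait, hg.advance hN, fun t ht => ?_⟩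
    rcases le_total t 1 with h1 | h1
    · have hd0 := hd 0 ⟨le_rfl, hN⟩
      rw [hf.apply_of_nonpos 0 le_rfl, hg.apply_of_nonpos 0 le_rfl] at hd0
      rw [hg.polyEval_advance q ht.1 h1, hf.polyEval_wait h1]
      exact dist_convexCombo_le ht.1 h1 (by rwa [polyEval_one]) hd0
    · rw [hg.polyEval_advance_of_one_le q h1]
      exact hd _ ⟨by linarith, by linarith [ht.2]⟩
  | @both p q P Q h _ ih =>
    obtain ⟨N, f, g, hN, hf, hg, hd⟩ := ih
    refine ⟨N + 1, _, _, by linarith, hf.advance hN, hg.advance hN, fun t ht => ?_⟩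
    rcases le_total t 1 with h1 | h1
    · have hd0 := hd 0 ⟨le_rfl, hN⟩
      rw [hf.apply_of_nonpos 0 le_rfl, hg.apply_of_nonpos 0 le_rfl] at hd0
      rw [hf.polyEval_advance p ht.1 h1, hg.polyEval_advance q ht.1 h1]
      exact dist_convexCombo_le ht.1 h1 h hd0
    · rw [hf.polyEval_advance_of_one_le p h1, hg.polyEval_advance_of_one_le q h1]
      exact hd _ ⟨by linarith, by linarith [ht.2]⟩

/-- The continuous Fréchet distance is at most the discrete one. -/
theorem Coupling.dF_le (h : Coupling δ P Q) : dF P Q ≤ δ := by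
  obtain ⟨N, f, g, hN, hf, hg, hd⟩ := h.exists_traversal
  refine csInf_le ⟨0, ?_⟩ ⟨_, _, hf.isReparam hN, hg.isReparam hN, fun t ht => hd _ ?_⟩
  · rintro D ⟨φ₁, φ₂, -, -, hD⟩
    exact dist_nonneg.trans (hD 0 ⟨le_rfl, zero_le_one⟩)
  · exact ⟨mul_nonneg hN ht.1, mul_le_of_le_one_right hN ht.2⟩

theorem Coupling.append_left {q : EuclideanSpace ℝ (Fin d)} {L : List (EuclideanSpace ℝ (Fin d))}
    (hL : ∀ p ∈ L, dist p q ≤ δ) (h : Coupling δ P (q :: Q)) :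
    Coupling δ (L ++ P) (q :: Q) := by
  induction L with
  | nil => exact h
  | cons a L ih =>
    rw [List.forall_mem_cons] at hL
    exact .left hL.1 (ih hL.2)

theorem Coupling.append_right {p : EuclideanSpace ℝ (Fin d)} {L : List (EuclideanSpace ℝ (Fin d))}
    (hL : ∀ q ∈ L, dist p q ≤ δ) (h : Coupling δ (p :: P) Q) :
    Coupling δ (p :: P) (L ++ Q) := by
  induction L with
  | nil => exact h
  | cons a L ih =>
    rw [List.forall_mem_cons] at hL
    exact .right hL.1 (ih hL.2)

theorem Coupling.append_both {L L' : List (EuclideanSpace ℝ (Fin d))}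
    (hL : List.Forall₂ (fun p q => dist p q ≤ δ) L L') (h : Coupling δ P Q) :
    Coupling δ (L ++ P) (L' ++ Q) := by
  induction hL with
  | nil => exact h
  | cons hpq _ ih => exact .both hpq ih

theorem Coupling.of_forall_dist_le {p q : EuclideanSpace ℝ (Fin d)} (hp : dist p q ≤ δ)
    (hP : ∀ p' ∈ P, dist p' q ≤ δ) : Coupling δ (p :: P) [q] := by
  induction P generalizing p with
  | nil => exact .single hp
  | cons a P ih =>
    rw [List.forall_mem_cons] at hP
    exact .left hp (ih hP.1 hP.2)

end Reparametrization

section Gadgets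

theorem dist_pt_le_one {a b c e : ℝ} (h : (a - c) ^ 2 + (b - e) ^ 2 ≤ 1) :
    dist (pt a b) (pt c e) ≤ 1 := by
  rw [EuclideanSpace.dist_eq, Real.sqrt_le_one]
  simpa [pt, Fin.sum_univ_two, Real.dist_eq] using h

theorem abs_mod_two_div_three_le (i : ℕ) : |((i % 2 : ℕ) : ℝ) / 3| ≤ 1 / 3 := by
  rcases Nat.mod_two_eq_zero_or_one i with h | h <;> norm_num [h]

theorem mem_gadget_one {A : Type*} {M : ℕ} {sat : A → ℕ → Bool} {a : A}
    {p : EuclideanSpace ℝ (Fin 2)} (hp : p ∈ ss1 :: (AG1 M sat a ++ [tt1])) :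
    ∃ x y, p = pt x y ∧ |x| ≤ 1 / 3 ∧ |y| ≤ 1 / 2 + eps := by
  simp only [AG1, CG1, List.cons_append, List.mem_cons, List.mem_append, List.mem_map,
    List.not_mem_nil, or_false] at hp
  rcases hp with rfl | rfl | ⟨k, -, rfl⟩ | rfl
  · exact ⟨_, _, rfl, by norm_num [abs_le], by norm_num [abs_le, eps]⟩
  · exact ⟨_, _, rfl, by norm_num [abs_le], by norm_num [abs_le, eps]⟩
  · exact ⟨_, _, rfl, abs_mod_two_div_three_le _, by split_ifs <;> norm_num [abs_le, eps]⟩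
  · exact ⟨_, _, rfl, by norm_num [abs_le], by norm_num [abs_le, eps]⟩

theorem mem_AG2 {A : Type*} {M : ℕ} {sat : A → ℕ → Bool} {a : A}
    {p : EuclideanSpace ℝ (Fin 2)} (hp : p ∈ AG2 M sat a) :
    ∃ x y, p = pt x y ∧ |x| ≤ 1 / 3 ∧ |y + 1 / 2| ≤ eps := by
  simp only [AG2, CG2, List.mem_cons, List.mem_map] at hp
  rcases hp with rfl | ⟨k, -, rfl⟩
  · exact ⟨_, _, rfl, by norm_num [abs_le], by norm_num [abs_le, eps]⟩
  · exact ⟨_, _, rfl, abs_mod_two_div_three_le _, by split_ifs <;> norm_num [abs_le, eps]⟩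

theorem dist_gadget_one_le {A : Type*} {M : ℕ} {sat : A → ℕ → Bool} {l : List A} {c : ℝ}
    (hc : |c| ≤ 1 / 3) :
    ∀ p ∈ l.flatMap fun a => ss1 :: (AG1 M sat a ++ [tt1]), dist p (pt c 0) ≤ 1 := by
  intro p hp
  obtain ⟨a, -, hp⟩ := List.mem_flatMap.1 hp
  obtain ⟨x, y, rfl, hx, hy⟩ := mem_gadget_one hp
  refine dist_pt_le_one ?_
  simp only [eps, abs_le] at hx hy hc
  nlinarith

theorem dist_AG2_le {A : Type*} {M : ℕ} {sat : A → ℕ → Bool} {l : List A} {c : ℝ}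
    (hc : |c| ≤ 1 / 3) :
    ∀ q ∈ l.flatMap fun a => AG2 M sat a, dist (pt c (1 / 5)) q ≤ 1 := by
  intro q hq
  obtain ⟨a, -, hq⟩ := List.mem_flatMap.1 hq
  obtain ⟨x, y, rfl, hx, hy⟩ := mem_AG2 hq
  refine dist_pt_le_one ?_
  simp only [eps, abs_le] at hx hy hc
  nlinarith

theorem dist_CG_le {A1 A2 : Type*} {sat1 : A1 → ℕ → Bool} {sat2 : A2 → ℕ → Bool} {a1 : A1}
    {a2 : A2} {i : ℕ} (h : sat1 a1 i = true ∨ sat2 a2 i = true) :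
    dist (CG1 sat1 a1 i) (CG2 sat2 a2 i) ≤ 1 := by
  refine dist_pt_le_one ?_
  cases h1 : sat1 a1 i <;> cases h2 : sat2 a2 i <;> simp [h1, h2, eps] at h ⊢ <;> norm_num

theorem Satisfying.forall₂_AG {A1 A2 : Type*} {M : ℕ} {sat1 : A1 → ℕ → Bool}
    {sat2 : A2 → ℕ → Bool} {a1 : A1} {a2 : A2} (h : Satisfying M sat1 sat2 a1 a2) :
    List.Forall₂ (fun p q => dist p q ≤ 1) (AG1 M sat1 a1) (AG2 M sat2 a2) := by
  refine .cons (dist_pt_le_one (by norm_num)) ?_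
  rw [List.forall₂_map_left_iff, List.forall₂_map_right_iff, List.forall₂_same]
  exact fun k hk => dist_CG_le (h _ (by omega) (by have := List.mem_range.1 hk; omega))

end Gadgets

/-- if `A_1 × A_2` contains a satisfying pair, then the continuous
Fréchet distance satisfies `d_F(P_1, P_2) ≤ 1`. -/
theorem stmt8 (M K1 K2 : ℕ) (hM : 1 ≤ M) (hK1 : 1 ≤ K1) (hK2 : 1 ≤ K2)
    (sat1 : Fin K1 → ℕ → Bool) (sat2 : Fin K2 → ℕ → Bool)
    (h : ∃ a1 : Fin K1, ∃ a2 : Fin K2, Satisfying M sat1 sat2 a1 a2) :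
    dF (Pone M K1 sat1) (Ptwo M K2 sat2) ≤ 1 := by
  obtain ⟨a1, a2, hsat⟩ := h
  obtain ⟨l1, m1, h1⟩ := List.append_of_mem (List.mem_finRange a1)
  obtain ⟨l2, m2, h2⟩ := List.append_of_mem (List.mem_finRange a2)
  have hneg : |(-(1 / 3) : ℝ)| ≤ 1 / 3 := by norm_num [abs_le]
  have hpos : |(1 / 3 : ℝ)| ≤ 1 / 3 := by norm_num [abs_le]
  apply Coupling.dF_le
  simp only [Pone, Ptwo, h1, h2, List.flatMap_append, List.flatMap_cons, List.append_assoc,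
    List.cons_append, List.nil_append]
  refine .append_left (dist_gadget_one_le hneg) ?_
  refine .right (dist_pt_le_one (by norm_num)) (.right (dist_pt_le_one (by norm_num)) ?_)
  refine .append_right (dist_AG2_le hneg) ?_
  refine .left (dist_pt_le_one (by norm_num)) ?_
  refine .append_both hsat.forall₂_AG ?_
  refine .append_right (dist_AG2_le hpos) ?_
  refine .right (dist_pt_le_one (by norm_num)) ?_
  exact .of_forall_dist_le (dist_pt_le_one (by norm_num)) (dist_gadget_one_le hpos)
end
end

section
/- Let j ≥ 1 and let π be a polygonal curve in ℝ² all of whose vertices lie within Euclidean distance 1 of the point (2jρ, ρ). Then d_dF(U_L(2j) ∘ π ∘ U_R(2j), U(2j−1)) ≤ 1 and d_dF(U_L(2j) ∘ π ∘ U_R(2j), U(2j+1)) ≤ 1. -/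
noncomputable section
open Real

/-- `ρ = 1/√2`. -/
def rho : ℝ := 1 / Real.sqrt 2

/-- The curve `U_L(j)`. -/
def UL (j : ℕ) : List (EuclideanSpace ℝ (Fin 2)) :=
  [pt ((j : ℝ) * rho) 0, pt (((j : ℝ) - 1) * rho) rho, pt (((j : ℝ) - 1) * rho) (3 * rho),
   pt (((j : ℝ) - 1) * rho) (2 * rho), pt (((j : ℝ) - 1) * rho) rho]

/-- The curve `U_R(j)`. -/
def UR (j : ℕ) : List (EuclideanSpace ℝ (Fin 2)) :=
  [pt (((j : ℝ) + 1) * rho) rho, pt (((j : ℝ) + 1) * rho) (2 * rho),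
   pt (((j : ℝ) + 1) * rho) (3 * rho), pt (((j : ℝ) + 1) * rho) rho, pt ((j : ℝ) * rho) 0]

/-- The curve `U(j) = U_L(j) ∘ U_R(j)`. -/
def Ucurve (j : ℕ) : List (EuclideanSpace ℝ (Fin 2)) := UL j ++ UR j

/-- Translation of a polygonal curve by `z` in the `x`-direction. -/
def trX (z : ℝ) (P : List (EuclideanSpace ℝ (Fin 2))) : List (EuclideanSpace ℝ (Fin 2)) :=
  P.map fun p => p + pt z 0

/-- Some discrete traversal of `P` and `Q` has width at most `D`. -/
def HasTraversal {d : ℕ} (D : ℝ) (P Q : List (EuclideanSpace ℝ (Fin d))) : Prop :=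
  ∃ T : List (ℕ × ℕ), IsTraversal P.length Q.length T ∧
    ∀ p ∈ T, dist (P.getD p.1 0) (Q.getD p.2 0) ≤ D

namespace HasTraversal

variable {d : ℕ} {D : ℝ} {a b : EuclideanSpace ℝ (Fin d)} {P Q : List (EuclideanSpace ℝ (Fin d))}

theorem dDF_le (h : HasTraversal D P Q) : dDF P Q ≤ D := by
  refine csInf_le ⟨0, ?_⟩ h
  rintro x ⟨T, hT, hx⟩
  exact dist_nonneg.trans (hx (0, 0) (List.mem_of_mem_head? hT.1))

theorem singleton (h : dist a b ≤ D) : HasTraversal D [a] [b] :=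
  ⟨[(0, 0)], ⟨rfl, rfl, List.isChain_singleton _, by simp⟩, by simpa using h⟩

/-- Prepend the pair `(0, 0)` to a traversal whose indices are shifted by `(1, e)`, `e ≤ 1`. -/
theorem isTraversal_shift {n m e : ℕ} {T : List (ℕ × ℕ)} (he : e ≤ 1)
    (hT : IsTraversal n m T) :
    IsTraversal (n + 1) (m + e) ((0, 0) :: T.map fun p => (p.1 + 1, p.2 + e)) := by
  obtain ⟨hh, hl, hc, hb⟩ := hT
  have h0 := hb _ (List.mem_of_mem_head? hh)
  refine ⟨rfl, ?_, ?_, ?_⟩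
  · rw [List.getLast?_cons, List.getLast?_map, hl]
    simp only [Option.map_some, Option.getD_some, Option.some.injEq, Prod.mk.injEq]
    simp only at h0
    omega
  · refine List.isChain_cons.2 ⟨?_, ?_⟩
    · intro y hy
      rw [List.head?_map, hh] at hy
      simp only [Option.map_some, Option.mem_def, Option.some.injEq] at hy
      subst hy
      interval_cases e <;> simp [IsStep]
    · rw [List.isChain_map]
      refine hc.imp fun x y hxy => ?_
      simp only [IsStep] at hxy ⊢
      omega
  · intro p hp
    rcases List.mem_cons.1 hp with rfl | hp
    · simp only at h0 ⊢
      omega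
    · obtain ⟨q, hq, rfl⟩ := List.mem_map.1 hp
      have := hb q hq
      simp only
      omega

theorem cons_cons (h : dist a b ≤ D) (H : HasTraversal D P Q) :
    HasTraversal D (a :: P) (b :: Q) := by
  obtain ⟨T, hT, hD⟩ := H
  refine ⟨_, isTraversal_shift le_rfl hT, List.forall_mem_cons.2 ⟨h, List.forall_mem_map.2 hD⟩⟩

theorem cons_left (h : dist a b ≤ D) (H : HasTraversal D P (b :: Q)) :
    HasTraversal D (a :: P) (b :: Q) := by
  obtain ⟨T, hT, hD⟩ := H
  refine ⟨_, isTraversal_shift (e := 0) zero_le_one hT,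
    List.forall_mem_cons.2 ⟨h, List.forall_mem_map.2 hD⟩⟩

theorem append_left {L : List (EuclideanSpace ℝ (Fin d))} (hL : ∀ p ∈ L, dist p b ≤ D)
    (H : HasTraversal D P (b :: Q)) : HasTraversal D (L ++ P) (b :: Q) := by
  induction L with
  | nil => exact H
  | cons x L ih =>
    exact cons_left (hL x (by simp)) (ih fun p hp => hL p (by simp [hp]))

theorem cons_append_cons {L : List (EuclideanSpace ℝ (Fin d))} (h : dist a b ≤ D)
    (hL : ∀ p ∈ L, dist p b ≤ D) (H : HasTraversal D P Q) :
    HasTraversal D (a :: (L ++ P)) (b :: Q) := by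
  induction L generalizing a with
  | nil => exact cons_cons h H
  | cons x L ih =>
    exact cons_left h (ih (hL x (by simp)) fun p hp => hL p (by simp [hp]))

end HasTraversal

theorem rho_nonneg : 0 ≤ rho := by
  unfold rho
  positivity

theorem rho_le_one : rho ≤ 1 := by
  unfold rho
  rw [div_le_one (by positivity)]
  exact Real.one_le_sqrt.2 (by norm_num)

theorem dist_pt_le_one_s10 {x x' y : ℝ} (h : |x - x'| ≤ 1) :
    dist (pt (x * rho) y) (pt (x' * rho) y) ≤ 1 := by
  have hd : dist (pt (x * rho) y) (pt (x' * rho) y) = |x - x'| * rho := by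
    rw [EuclideanSpace.dist_eq]
    simp [pt, Real.dist_eq, Real.sqrt_sq_eq_abs, ← sub_mul, abs_mul, abs_of_nonneg rho_nonneg]
  rw [hd]
  exact mul_le_one₀ h rho_nonneg rho_le_one

/-- for `j ≥ 1` and a polygonal curve `π` all of whose vertices lie
within distance 1 of `(2jρ, ρ)`, both `d_dF(U_L(2j) ∘ π ∘ U_R(2j), U(2j−1)) ≤ 1` and
`d_dF(U_L(2j) ∘ π ∘ U_R(2j), U(2j+1)) ≤ 1`. -/
theorem stmt10 (j : ℕ) (hj : 1 ≤ j) (pc : List (EuclideanSpace ℝ (Fin 2)))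
    (hπ : ∀ p ∈ pc, dist p (pt (2 * (j : ℝ) * rho) rho) ≤ 1) :
    dDF (UL (2 * j) ++ pc ++ UR (2 * j)) (Ucurve (2 * j - 1)) ≤ 1 ∧
    dDF (UL (2 * j) ++ pc ++ UR (2 * j)) (Ucurve (2 * j + 1)) ≤ 1 := by
  have hcast : ((2 * j - 1 : ℕ) : ℝ) = 2 * (j : ℝ) - 1 := by
    rw [Nat.cast_sub (by omega)]
    push_cast
    ring
  have hd {x x' y : ℝ} (h : x - x' = 1 ∨ x - x' = -1) :
      dist (pt (x * rho) y) (pt (x' * rho) y) ≤ 1 := by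
    refine dist_pt_le_one_s10 ?_
    rcases h with h | h <;> simp [h]
  constructor
  · apply HasTraversal.dDF_le
    simp only [Ucurve, UL, UR, List.cons_append, List.nil_append, hcast, Nat.cast_mul,
      Nat.cast_ofNat]
    iterate 5 refine .cons_cons (hd (by left; ring)) ?_
    refine .append_left (by simpa using hπ) ?_
    iterate 4 refine .cons_cons (hd (by left; ring)) ?_
    exact .singleton (hd (by left; ring))
  · apply HasTraversal.dDF_le
    simp only [Ucurve, UL, UR, List.cons_append, List.nil_append, Nat.cast_mul,
      Nat.cast_ofNat, Nat.cast_add, Nat.cast_one]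
    iterate 4 refine .cons_cons (hd (by right; ring)) ?_
    refine .cons_append_cons (hd (by right; ring)) (by simpa using hπ) ?_
    iterate 4 refine .cons_cons (hd (by right; ring)) ?_
    exact .singleton (hd (by right; ring))
end
end
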